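/- Let α = gcd(α_x, α_y, α_z) with β_y = α_y/α odd. Then each half-plane operator is a logical operator and is generated by the square logical operators: for each i ∈ {0,1,2,3}, ω(S_s, X|_{D_x^{g_i}}) = 0 and ω(S_s, Z|_{D_z^{g_i}}) = 0 for all s ∈ A \ D, X|_{D_x^{g_i}} ∉ 𝒮 and Z|_{D_z^{g_i}} ∉ 𝒮, and moreover X|_{D_x^{g_i}} = Σ_{j=0}^{α−1} X_{Li}^j and Z|_{D_z^{g_i}} = Σ_{j=0}^{α−1} Z_{Li}^j (componentwise sums of Pauli operators over ZMod 2; equivalently, the pointwise ZMod-2 sum over j of the indicators of D_x^{i,j} equals the indicator of D_x^{g_i}, and likewise for the Z-supports). -/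

import Mathlib

namespace Chamon

/-- Ambient group `A = ZMod (2αx) × ZMod (2αy) × ZMod (2αz)`. -/
abbrev Amb (ax ay az : ℕ) : Type :=
  ZMod (2 * ax) × ZMod (2 * ay) × ZMod (2 * az)

/-- Reduction mod 2 of a coordinate. -/
def par {n : ℕ} (a : ZMod (2 * n)) : ZMod 2 :=
  ZMod.castHom (dvd_mul_right 2 n) (ZMod 2) a

variable (ax ay az : ℕ)

def ex : Amb ax ay az := (1, 0, 0)
def ey : Amb ax ay az := (0, 1, 0)
def ez : Amb ax ay az := (0, 0, 1)

/-- The data-qubit set `D`. -/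
def dataSet : Set (Amb ax ay az) :=
  {a | par a.1 + par a.2.1 + par a.2.2 = 0}

/-- A Pauli operator (modulo phase): a pair of functions `D → ZMod 2`. -/
abbrev Pauli : Type :=
  (↥(dataSet ax ay az) → ZMod 2) × (↥(dataSet ax ay az) → ZMod 2)

/-- The stabilizer generator `S_s`. -/
def stab (s : Amb ax ay az) : Pauli ax ay az :=
  (fun d =>
      (if (d : Amb ax ay az) = s + ex ax ay az then 1 else 0) +
      (if (d : Amb ax ay az) = s - ex ax ay az then 1 else 0) +
      (if (d : Amb ax ay az) = s + ey ax ay az then 1 else 0) +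
      (if (d : Amb ax ay az) = s - ey ax ay az then 1 else 0),
   fun d =>
      (if (d : Amb ax ay az) = s + ez ax ay az then 1 else 0) +
      (if (d : Amb ax ay az) = s - ez ax ay az then 1 else 0) +
      (if (d : Amb ax ay az) = s + ey ax ay az then 1 else 0) +
      (if (d : Amb ax ay az) = s - ey ax ay az then 1 else 0))

/-- The symplectic form `ω(P,Q)`. -/
noncomputable def sympl (P Q : Pauli ax ay az) : ZMod 2 :=
  ∑ᶠ d : ↥(dataSet ax ay az), (P.1 d * Q.2 d + P.2 d * Q.1 d)

/-- `X|_E`: X-part is the indicator of `E`, Z-part is zero. -/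
noncomputable def Xop (E : Set (Amb ax ay az)) : Pauli ax ay az :=
  (fun d => E.indicator (fun _ => (1 : ZMod 2)) (d : Amb ax ay az), fun _ => 0)

/-- `Z|_E`: Z-part is the indicator of `E`, X-part is zero. -/
noncomputable def Zop (E : Set (Amb ax ay az)) : Pauli ax ay az :=
  (fun _ => 0, fun d => E.indicator (fun _ => (1 : ZMod 2)) (d : Amb ax ay az))

/-- The `ZMod 2`-linear span `𝒮` of the stabilizer generators. -/
def stabSpan : Submodule (ZMod 2) (Pauli ax ay az) :=
  Submodule.span (ZMod 2) (stab ax ay az '' (dataSet ax ay az)ᶜ)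

/-- The four generating points `g₀, g₁, g₂, g₃`. -/
def gpt : Fin 4 → Amb ax ay az := ![(0,0,0), (1,1,0), (1,0,1), (0,1,1)]

/-- Half-plane support `D_x^g` (parallel to the `yOz` plane). -/
def Dxg (g : Amb ax ay az) : Set (Amb ax ay az) :=
  {d | ∃ l m : ℤ, d = g + (2*l) • ez ax ay az + (2*m) • ey ax ay az}

/-- Half-plane support `D_z^g` (parallel to the `xOy` plane). -/
def Dzg (g : Amb ax ay az) : Set (Amb ax ay az) :=
  {d | ∃ l m : ℤ, d = g + (2*l) • ex ax ay az + (2*m) • ey ax ay az}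

end Chamon


namespace Chamon

/-- `μ_i = (−1)^⌊i/2⌋`. -/
def sgnMu (i : Fin 4) : ℤ := (-1) ^ ((i : ℕ) / 2)

/-- `ν_i = (−1)^(⌈i/2⌉ mod 2)`. -/
def sgnNu (i : Fin 4) : ℤ := (-1) ^ ((((i : ℕ) + 1) / 2) % 2)

/-- `g_{i,j} = g_i + 2j e_y⁺`. -/
def gij (ax ay az : ℕ) (i : Fin 4) (j : ℕ) : Amb ax ay az :=
  gpt ax ay az i + (2 * (j : ℤ)) • ey ax ay az

/-- Generalized square support
`D_x^{i,j} = {g + λ(μ_i e_z⁺ + e_y⁺) + λ'(μ_i e_z⁺ + e_y⁻) : 0 ≤ λ, λ' < α, g ∈ G_{i,j}^x}`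
where `G_{i,j}^x = {g_{i,j} + 2κα e_y⁺ + 2κ'α e_z⁺ : 0 ≤ κ < βy, 0 ≤ κ' < βz}`. -/
def DxSqG (ax ay az α βy βz : ℕ) (i : Fin 4) (j : ℕ) : Set (Amb ax ay az) :=
  {d | ∃ k k' l l' : ℤ,
    0 ≤ k ∧ k < (βy : ℤ) ∧ 0 ≤ k' ∧ k' < (βz : ℤ) ∧
    0 ≤ l ∧ l < (α : ℤ) ∧ 0 ≤ l' ∧ l' < (α : ℤ) ∧
    d = gij ax ay az i j + (2*k*(α : ℤ)) • ey ax ay az + (2*k'*(α : ℤ)) • ez ax ay az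
        + l • (sgnMu i • ez ax ay az + ey ax ay az)
        + l' • (sgnMu i • ez ax ay az - ey ax ay az)}

/-- Generalized square support
`D_z^{i,j} = {g + λ(ν_i e_x⁺ + e_y⁺) + λ'(ν_i e_x⁺ + e_y⁻) : 0 ≤ λ, λ' < α, g ∈ G_{i,j}^z}`
where `G_{i,j}^z = {g_{i,j} + 2κα e_y⁺ + 2κ'α e_x⁺ : 0 ≤ κ < βy, 0 ≤ κ' < βx}`. -/
def DzSqG (ax ay az α βy βx : ℕ) (i : Fin 4) (j : ℕ) : Set (Amb ax ay az) :=
  {d | ∃ k k' l l' : ℤ,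
    0 ≤ k ∧ k < (βy : ℤ) ∧ 0 ≤ k' ∧ k' < (βx : ℤ) ∧
    0 ≤ l ∧ l < (α : ℤ) ∧ 0 ≤ l' ∧ l' < (α : ℤ) ∧
    d = gij ax ay az i j + (2*k*(α : ℤ)) • ey ax ay az + (2*k'*(α : ℤ)) • ex ax ay az
        + l • (sgnNu i • ex ax ay az + ey ax ay az)
        + l' • (sgnNu i • ex ax ay az - ey ax ay az)}

end Chamon

namespace Chamon

section Parity

variable {n : ℕ}

lemma par_intCast (m : ℤ) : par ((m : ℤ) : ZMod (2 * n)) = (m : ZMod 2) := by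
  simp [par]

lemma par_add (a b : ZMod (2 * n)) : par (a + b) = par a + par b := map_add _ a b

lemma par_sub (a b : ZMod (2 * n)) : par (a - b) = par a - par b := map_sub _ a b

lemma par_zero : par (0 : ZMod (2 * n)) = 0 := map_zero _

lemma par_one : par (1 : ZMod (2 * n)) = 1 := map_one _

lemma par_sub_one (a : ZMod (2 * n)) : par (a - 1) = par (a + 1) := by
  rw [par_sub, par_add, par_one]
  generalize par a = p
  revert p
  decide

lemma par_eq_iff_exists (a b : ZMod (2 * n)) :
    par a = par b ↔ ∃ m : ℤ, a = b + ((2 * m : ℤ) : ZMod (2 * n)) := by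
  constructor
  · obtain ⟨p, rfl⟩ := ZMod.intCast_surjective a
    obtain ⟨q, rfl⟩ := ZMod.intCast_surjective b
    rw [par_intCast, par_intCast, ZMod.intCast_eq_intCast_iff_dvd_sub]
    rintro ⟨c, hc⟩
    refine ⟨-c, ?_⟩
    rw [← Int.cast_add]
    congr 1
    push_cast at hc
    linarith
  · rintro ⟨m, rfl⟩
    rw [par_add, par_intCast]
    have h2 : ((2 : ℤ) : ZMod 2) = 0 := by decide
    rw [Int.cast_mul, h2, zero_mul, add_zero]

end Parity

section Squares

/-- The planar pattern underlying the square supports, in coordinates relative to `g_i`. -/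
def squarePattern (a b α β γ : ℕ) (μ : ℤ) (j : ℕ) : Set (ZMod (2 * a) × ZMod (2 * b)) :=
  {p | ∃ k k' l l' : ℤ,
    0 ≤ k ∧ k < (β : ℤ) ∧ 0 ≤ k' ∧ k' < (γ : ℤ) ∧
    0 ≤ l ∧ l < (α : ℤ) ∧ 0 ≤ l' ∧ l' < (α : ℤ) ∧
    p.1 = ((2 * j + 2 * k * α + (l - l') : ℤ) : ZMod (2 * a)) ∧
    p.2 = ((2 * k' * α + μ * (l + l') : ℤ) : ZMod (2 * b))}

lemma exists_intCast_eq_add_iff {a α β : ℕ} (hβ : 0 < β) (ha : a = β * α) (Y r : ℤ) :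
    (∃ k : ℤ, 0 ≤ k ∧ k < (β : ℤ) ∧
      ((Y : ℤ) : ZMod (2 * a)) = ((r + 2 * k * α : ℤ) : ZMod (2 * a))) ↔
      (2 * α : ℤ) ∣ Y - r := by
  subst ha
  constructor
  · rintro ⟨k, -, -, h⟩
    rw [ZMod.intCast_eq_intCast_iff_dvd_sub] at h
    obtain ⟨c, hc⟩ := h
    push_cast at hc
    exact ⟨k - β * c, by linear_combination -hc⟩
  · rintro ⟨c, hc⟩
    have hβ' : (0 : ℤ) < β := by exact_mod_cast hβ
    refine ⟨c % β, Int.emod_nonneg _ hβ'.ne', Int.emod_lt_of_pos _ hβ', ?_⟩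
    rw [ZMod.intCast_eq_intCast_iff_dvd_sub]
    refine ⟨-(c / β), ?_⟩
    push_cast
    linear_combination (-1 : ℤ) * hc + 2 * (α : ℤ) * (Int.emod_add_mul_ediv c β)

lemma mem_squarePattern_iff {a b α β γ : ℕ} (hβ : 0 < β) (hγ : 0 < γ)
    (ha : a = β * α) (hb : b = γ * α) (μ : ℤ) (j : ℕ) (Y W : ℤ) :
    (((Y : ℤ) : ZMod (2 * a)), ((W : ℤ) : ZMod (2 * b))) ∈ squarePattern a b α β γ μ j ↔
      ∃ l l' : ℤ, 0 ≤ l ∧ l < (α : ℤ) ∧ 0 ≤ l' ∧ l' < (α : ℤ) ∧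
        (2 * α : ℤ) ∣ Y - (2 * j + (l - l')) ∧ (2 * α : ℤ) ∣ W - μ * (l + l') := by
  constructor
  · rintro ⟨k, k', l, l', h1, h2, h3, h4, h5, h6, h7, h8, h9, h10⟩
    refine ⟨l, l', h5, h6, h7, h8, (exists_intCast_eq_add_iff hβ ha _ _).1 ⟨k, h1, h2, ?_⟩,
      (exists_intCast_eq_add_iff hγ hb _ _).1 ⟨k', h3, h4, ?_⟩⟩
    · exact h9.trans (congrArg _ (by ring))
    · exact h10.trans (congrArg _ (by ring))
  · rintro ⟨l, l', h5, h6, h7, h8, hY, hW⟩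
    obtain ⟨k, h1, h2, h9⟩ := (exists_intCast_eq_add_iff hβ ha _ _).2 hY
    obtain ⟨k', h3, h4, h10⟩ := (exists_intCast_eq_add_iff hγ hb _ _).2 hW
    refine ⟨k, k', l, l', h1, h2, h3, h4, h5, h6, h7, h8, ?_, ?_⟩
    · exact h9.trans (congrArg _ (by ring))
    · exact h10.trans (congrArg _ (by ring))

open Classical in
lemma card_filter_translates {α : ℕ} (hα : 0 < α) {μ : ℤ} (hμ : μ = 1 ∨ μ = -1) {Y W : ℤ}
    (hYW : Even (Y + W)) :
    (((Finset.range α).filter fun j : ℕ => ∃ l l' : ℤ,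
      0 ≤ l ∧ l < (α : ℤ) ∧ 0 ≤ l' ∧ l' < (α : ℤ) ∧
        (2 * α : ℤ) ∣ Y - (2 * j + (l - l')) ∧ (2 * α : ℤ) ∣ W - μ * (l + l')).card : ZMod 2) =
      if Even W then 1 else 0 := by
  have hα' : (0 : ℤ) < α := by exact_mod_cast hα
  obtain ⟨w, hw0, hw1, hw⟩ : ∃ w : ℤ, 0 ≤ w ∧ w < 2 * α ∧ (2 * α : ℤ) ∣ μ * W - w :=
    ⟨(μ * W) % (2 * α), Int.emod_nonneg _ (by omega), Int.emod_lt_of_pos _ (by omega),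
      Int.dvd_self_sub_emod⟩
  have hμμ : μ * μ = 1 := by rcases hμ with rfl | rfl <;> norm_num
  have hpar : Even W ↔ Even w := by
    have h2 : (2 : ℤ) ∣ μ * W - w := (Dvd.intro _ rfl).trans hw
    rcases hμ with rfl | rfl <;> simp only [even_iff_two_dvd] <;> omega
  have hYw : ∃ h : ℤ, Y + w = 2 * h := by
    rw [Int.even_add, hpar, ← Int.even_add] at hYW
    obtain ⟨h, hh⟩ := hYW
    exact ⟨h, by omega⟩
  obtain ⟨h, hh⟩ := hYw
  have hsum : ∀ l l' : ℤ, 0 ≤ l → l < α → 0 ≤ l' → l' < α →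
      ((2 * α : ℤ) ∣ W - μ * (l + l') ↔ l + l' = w) := by
    intro l l' h1 h2 h3 h4
    constructor
    · intro hd
      have h5 : (2 * α : ℤ) ∣ w - (l + l') := by
        have h6 := dvd_sub (hd.mul_left μ) hw
        have h7 : μ * (W - μ * (l + l')) - (μ * W - w) = w - (l + l') := by
          linear_combination (-(l + l')) * hμμ
        rwa [h7] at h6
      have h8 := Int.eq_zero_of_abs_lt_dvd h5 (by rw [abs_lt]; constructor <;> omega)
      omega
    · rintro rfl
      have h6 := hw.mul_left μ
      have h7 : μ * (μ * W - (l + l')) = W - μ * (l + l') := by linear_combination W * hμμ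
      rwa [h7] at h6
  have himage : ((Finset.range α).filter fun j : ℕ => ∃ l l' : ℤ,
      0 ≤ l ∧ l < (α : ℤ) ∧ 0 ≤ l' ∧ l' < (α : ℤ) ∧
        (2 * α : ℤ) ∣ Y - (2 * j + (l - l')) ∧ (2 * α : ℤ) ∣ W - μ * (l + l')) =
      (Finset.Icc (max 0 (w - α + 1)) (min (α - 1) w)).image
        fun l : ℤ => ((h - l) % α).toNat := by
    ext j
    simp only [Finset.mem_filter, Finset.mem_range, Finset.mem_image, Finset.mem_Icc]
    constructor
    · rintro ⟨hj, l, l', h1, h2, h3, h4, h5, h6⟩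
      rw [hsum l l' h1 h2 h3 h4] at h6
      refine ⟨l, by omega, ?_⟩
      have h7 : (h - l) % α = (j : ℤ) := by
        obtain ⟨c, hc⟩ := h5
        have h8 : h - l = j + α * c := by linarith
        rw [h8, Int.add_mul_emod_self_left]
        exact Int.emod_eq_of_lt (by omega) (by omega)
      rw [h7, Int.toNat_natCast]
    · rintro ⟨l, hl, hj⟩
      have h7 := Int.emod_nonneg (h - l) hα'.ne'
      have h8 := Int.emod_lt_of_pos (h - l) hα'
      have h9 : (j : ℤ) = (h - l) % α := by omega
      refine ⟨by omega, l, w - l, by omega, by omega, by omega, by omega, ⟨(h - l) / α, ?_⟩, ?_⟩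
      · rw [h9]
        linear_combination hh - 2 * Int.emod_add_mul_ediv (h - l) α
      · rw [hsum l (w - l) (by omega) (by omega) (by omega) (by omega)]
        ring
  have hinj : Set.InjOn (fun l : ℤ => ((h - l) % α).toNat)
      (Finset.Icc (max 0 (w - α + 1)) (min (α - 1) w) : Finset ℤ) := by
    intro l hl m hm hlm
    simp only [Finset.coe_Icc, Set.mem_Icc] at hl hm
    have h1 := Int.emod_nonneg (h - l) hα'.ne'
    have h2 := Int.emod_nonneg (h - m) hα'.ne'
    have h3 : (h - l) % α = (h - m) % α := by
      simp only at hlm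
      omega
    have h4 : (α : ℤ) ∣ (h - m) - (h - l) := Int.ModEq.dvd h3
    have h5 := Int.eq_zero_of_abs_lt_dvd h4 (by rw [abs_lt]; constructor <;> omega)
    omega
  rw [himage, Finset.card_image_of_injOn hinj, Int.card_Icc]
  have hcard : Even (min ((α : ℤ) - 1) w + 1 - max 0 (w - α + 1)).toNat ↔ ¬ Even W := by
    rw [hpar, Int.even_iff, Nat.even_iff]
    omega
  split_ifs with hW
  · rw [ZMod.natCast_eq_one_iff_odd, ← Nat.not_even_iff_odd, hcard]
    exact not_not.mpr hW
  · rwa [ZMod.natCast_eq_zero_iff_even, hcard]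

lemma sum_indicator_squarePattern {a b α β γ : ℕ} (hα : 0 < α) (hβ : 0 < β) (hγ : 0 < γ)
    (ha : a = β * α) (hb : b = γ * α) {μ : ℤ} (hμ : μ = 1 ∨ μ = -1)
    (p : ZMod (2 * a) × ZMod (2 * b)) (hp : par p.1 = par p.2) :
    ∑ j ∈ Finset.range α, (squarePattern a b α β γ μ j).indicator (fun _ => (1 : ZMod 2)) p =
      if par p.2 = 0 then 1 else 0 := by
  classical
  obtain ⟨y, z⟩ := p
  obtain ⟨Y, rfl⟩ := ZMod.intCast_surjective y
  obtain ⟨W, rfl⟩ := ZMod.intCast_surjective z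
  simp only [par_intCast] at hp ⊢
  have hYW : Even (Y + W) := by
    rw [← ZMod.intCast_eq_zero_iff_even, Int.cast_add, hp]
    exact CharTwo.add_self_eq_zero _
  simp only [Set.indicator_apply, mem_squarePattern_iff hβ hγ ha hb, Finset.sum_boole,
    card_filter_translates hα hμ hYW, ZMod.intCast_eq_zero_iff_even]

end Squares

section Supports

variable {ax ay az : ℕ}

lemma mem_Dxg_iff (g d : Amb ax ay az) :
    d ∈ Dxg ax ay az g ↔ d.1 = g.1 ∧ par d.2.1 = par g.2.1 ∧ par d.2.2 = par g.2.2 := by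
  simp only [par_eq_iff_exists, Dxg, Set.mem_ofPred_eq, ey, ez]
  constructor
  · rintro ⟨l, m, rfl⟩
    exact ⟨by simp, ⟨m, by simp⟩, ⟨l, by simp⟩⟩
  · rintro ⟨h1, ⟨m, hm⟩, ⟨l, hl⟩⟩
    exact ⟨l, m, Prod.ext (by simp [h1]) (Prod.ext (by simp [hm]) (by simp [hl]))⟩

lemma mem_Dzg_iff (g d : Amb ax ay az) :
    d ∈ Dzg ax ay az g ↔ d.2.2 = g.2.2 ∧ par d.2.1 = par g.2.1 ∧ par d.1 = par g.1 := by
  simp only [par_eq_iff_exists, Dzg, Set.mem_ofPred_eq, ex, ey]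
  constructor
  · rintro ⟨l, m, rfl⟩
    exact ⟨by simp, ⟨m, by simp⟩, ⟨l, by simp⟩⟩
  · rintro ⟨h1, ⟨m, hm⟩, ⟨l, hl⟩⟩
    exact ⟨l, m, Prod.ext (by simp [hl]) (Prod.ext (by simp [hm]) (by simp [h1]))⟩

lemma mem_DxSqG_iff (α βy βz : ℕ) (i : Fin 4) (j : ℕ) (d : Amb ax ay az) :
    d ∈ DxSqG ax ay az α βy βz i j ↔ d.1 = (gpt ax ay az i).1 ∧
      (d.2.1 - (gpt ax ay az i).2.1, d.2.2 - (gpt ax ay az i).2.2) ∈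
        squarePattern ay az α βy βz (sgnMu i) j := by
  generalize hg : gpt ax ay az i = g
  obtain ⟨g1, g2, g3⟩ := g
  obtain ⟨d1, d2, d3⟩ := d
  simp only [DxSqG, squarePattern, gij, hg, Set.mem_ofPred_eq, ey, ez, Prod.smul_mk, Prod.mk_add_mk,
    Prod.mk_sub_mk, Prod.mk.injEq, zsmul_eq_mul, mul_zero, mul_one, add_zero, sub_zero, zero_add,
    sub_eq_iff_eq_add]
  constructor
  · rintro ⟨k, k', l, l', h1, h2, h3, h4, h5, h6, h7, h8, h9, h10, h11⟩
    refine ⟨h9, k, k', l, l', h1, h2, h3, h4, h5, h6, h7, h8, ?_, ?_⟩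
    · rw [h10]; push_cast; ring
    · rw [h11]; push_cast; ring
  · rintro ⟨h9, k, k', l, l', h1, h2, h3, h4, h5, h6, h7, h8, h10, h11⟩
    refine ⟨k, k', l, l', h1, h2, h3, h4, h5, h6, h7, h8, h9, ?_, ?_⟩
    · rw [h10]; push_cast; ring
    · rw [h11]; push_cast; ring

lemma mem_DzSqG_iff (α βy βx : ℕ) (i : Fin 4) (j : ℕ) (d : Amb ax ay az) :
    d ∈ DzSqG ax ay az α βy βx i j ↔ d.2.2 = (gpt ax ay az i).2.2 ∧
      (d.2.1 - (gpt ax ay az i).2.1, d.1 - (gpt ax ay az i).1) ∈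
        squarePattern ay ax α βy βx (sgnNu i) j := by
  generalize hg : gpt ax ay az i = g
  obtain ⟨g1, g2, g3⟩ := g
  obtain ⟨d1, d2, d3⟩ := d
  simp only [DzSqG, squarePattern, gij, hg, Set.mem_ofPred_eq, ey, ex, Prod.smul_mk, Prod.mk_add_mk,
    Prod.mk_sub_mk, Prod.mk.injEq, zsmul_eq_mul, mul_zero, mul_one, add_zero, sub_zero, zero_add,
    sub_eq_iff_eq_add]
  constructor
  · rintro ⟨k, k', l, l', h1, h2, h3, h4, h5, h6, h7, h8, h9, h10, h11⟩
    refine ⟨h11, k, k', l, l', h1, h2, h3, h4, h5, h6, h7, h8, ?_, ?_⟩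
    · rw [h10]; push_cast; ring
    · rw [h9]; push_cast; ring
  · rintro ⟨h11, k, k', l, l', h1, h2, h3, h4, h5, h6, h7, h8, h10, h9⟩
    refine ⟨k, k', l, l', h1, h2, h3, h4, h5, h6, h7, h8, ?_, ?_, h11⟩
    · rw [h9]; push_cast; ring
    · rw [h10]; push_cast; ring

lemma gpt_mem_dataSet (i : Fin 4) : gpt ax ay az i ∈ dataSet ax ay az := by
  fin_cases i <;> simp [gpt, dataSet, par_one, par_zero] <;> decide

lemma Xop_Dxg_eq_sum {α βy βz : ℕ} (hα : 0 < α) (hy : 0 < βy) (hz : 0 < βz)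
    (hay : ay = βy * α) (haz : az = βz * α) (i : Fin 4) :
    Xop ax ay az (Dxg ax ay az (gpt ax ay az i)) =
      ∑ j ∈ Finset.range α, Xop ax ay az (DxSqG ax ay az α βy βz i j) := by
  classical
  refine Prod.ext ?_ (by simp [Xop, Prod.snd_sum, funext_iff])
  funext d
  have hd : par d.1.1 + par d.1.2.1 + par d.1.2.2 = 0 := d.2
  have hg : par (gpt ax ay az i).1 + par (gpt ax ay az i).2.1 + par (gpt ax ay az i).2.2 = 0 :=
    gpt_mem_dataSet i
  simp only [Prod.fst_sum, Finset.sum_apply, Xop, Set.indicator_apply, mem_Dxg_iff,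
    mem_DxSqG_iff]
  by_cases h1 : d.1.1 = (gpt ax ay az i).1
  · rw [h1] at hd
    have hp : par (d.1.2.1 - (gpt ax ay az i).2.1) = par (d.1.2.2 - (gpt ax ay az i).2.2) := by
      rw [par_sub, par_sub]
      linear_combination (norm := ring_nf) hd - hg - CharTwo.two_eq_zero (R := ZMod 2) *
        (par d.1.2.2 - par (gpt ax ay az i).2.2)
    have key := sum_indicator_squarePattern hα hy hz hay haz (μ := sgnMu i)
      (neg_one_pow_eq_or ℤ _) (_, _) hp
    simp only [Set.indicator_apply] at key
    simp only [h1, true_and, key]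
    refine if_congr ?_ rfl rfl
    rw [← sub_eq_zero (a := par d.1.2.1), ← sub_eq_zero (a := par d.1.2.2), ← par_sub, ← par_sub,
      hp, and_self]
  · simp [h1]

lemma Zop_Dzg_eq_sum {α βy βx : ℕ} (hα : 0 < α) (hy : 0 < βy) (hx : 0 < βx)
    (hay : ay = βy * α) (hax : ax = βx * α) (i : Fin 4) :
    Zop ax ay az (Dzg ax ay az (gpt ax ay az i)) =
      ∑ j ∈ Finset.range α, Zop ax ay az (DzSqG ax ay az α βy βx i j) := by
  classical
  refine Prod.ext (by simp [Zop, Prod.fst_sum, funext_iff]) ?_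
  funext d
  have hd : par d.1.1 + par d.1.2.1 + par d.1.2.2 = 0 := d.2
  have hg : par (gpt ax ay az i).1 + par (gpt ax ay az i).2.1 + par (gpt ax ay az i).2.2 = 0 :=
    gpt_mem_dataSet i
  simp only [Prod.snd_sum, Finset.sum_apply, Zop, Set.indicator_apply, mem_Dzg_iff,
    mem_DzSqG_iff]
  by_cases h1 : d.1.2.2 = (gpt ax ay az i).2.2
  · rw [h1] at hd
    have hp : par (d.1.2.1 - (gpt ax ay az i).2.1) = par (d.1.1 - (gpt ax ay az i).1) := by
      rw [par_sub, par_sub]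
      linear_combination (norm := ring_nf) hd - hg - CharTwo.two_eq_zero (R := ZMod 2) *
        (par d.1.1 - par (gpt ax ay az i).1)
    have key := sum_indicator_squarePattern hα hy hx hay hax (μ := sgnNu i)
      (neg_one_pow_eq_or ℤ _) (_, _) hp
    simp only [Set.indicator_apply] at key
    simp only [h1, true_and, key]
    refine if_congr ?_ rfl rfl
    rw [← sub_eq_zero (a := par d.1.2.1), ← sub_eq_zero (a := par d.1.1), ← par_sub, ← par_sub,
      hp, and_self]
  · simp [h1]

end Supports

section Commutation

variable {ax ay az : ℕ}

lemma neighbors_mem_dataSet {s : Amb ax ay az} (hs : s ∉ dataSet ax ay az) :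
    (s + ex ax ay az ∈ dataSet ax ay az ∧ s - ex ax ay az ∈ dataSet ax ay az) ∧
    (s + ey ax ay az ∈ dataSet ax ay az ∧ s - ey ax ay az ∈ dataSet ax ay az) ∧
    (s + ez ax ay az ∈ dataSet ax ay az ∧ s - ez ax ay az ∈ dataSet ax ay az) := by
  simp only [dataSet, Set.mem_ofPred_eq, ex, ey, ez, Prod.fst_add, Prod.snd_add, Prod.fst_sub,
    Prod.snd_sub, add_zero, sub_zero, par_sub_one, par_add, par_one] at hs ⊢
  generalize par s.1 = a at *
  generalize par s.2.1 = b at *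
  generalize par s.2.2 = c at *
  revert a b c
  decide

lemma sympl_comm (P Q : Pauli ax ay az) : sympl ax ay az P Q = sympl ax ay az Q P :=
  finsum_congr fun d => by ring

lemma sum_ite_eq_mul [Fintype (dataSet ax ay az)] (a : Amb ax ay az) (ha : a ∈ dataSet ax ay az)
    (f : Amb ax ay az → ZMod 2) :
    ∑ d : dataSet ax ay az, (if (d : Amb ax ay az) = a then (1 : ZMod 2) else 0) * f d = f a := by
  rw [Finset.sum_eq_single ⟨a, ha⟩]
  · simp
  · rintro ⟨b, hb⟩ - hne
    rw [if_neg (fun h => hne (Subtype.ext h)), zero_mul]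
  · simp

variable [NeZero ax] [NeZero ay] [NeZero az]

instance finite_amb : Finite (Amb ax ay az) := by
  have : NeZero (2 * ax) := ⟨mul_ne_zero two_ne_zero (NeZero.ne ax)⟩
  have : NeZero (2 * ay) := ⟨mul_ne_zero two_ne_zero (NeZero.ne ay)⟩
  have : NeZero (2 * az) := ⟨mul_ne_zero two_ne_zero (NeZero.ne az)⟩
  infer_instance

lemma sympl_stab_Xop {s : Amb ax ay az} (hs : s ∉ dataSet ax ay az) (E : Set (Amb ax ay az)) :
    sympl ax ay az (stab ax ay az s) (Xop ax ay az E) =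
      E.indicator (fun _ => 1) (s + ez ax ay az) + E.indicator (fun _ => 1) (s - ez ax ay az) +
      E.indicator (fun _ => 1) (s + ey ax ay az) + E.indicator (fun _ => 1) (s - ey ax ay az) := by
  obtain ⟨-, ⟨h3, h4⟩, h5, h6⟩ := neighbors_mem_dataSet hs
  have := Fintype.ofFinite (dataSet ax ay az)
  simp only [sympl, finsum_eq_sum_of_fintype, stab, Xop, mul_zero, zero_add, add_mul,
    Finset.sum_add_distrib]
  rw [sum_ite_eq_mul _ h3, sum_ite_eq_mul _ h4, sum_ite_eq_mul _ h5, sum_ite_eq_mul _ h6]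

lemma sympl_stab_Zop {s : Amb ax ay az} (hs : s ∉ dataSet ax ay az) (E : Set (Amb ax ay az)) :
    sympl ax ay az (stab ax ay az s) (Zop ax ay az E) =
      E.indicator (fun _ => 1) (s + ex ax ay az) + E.indicator (fun _ => 1) (s - ex ax ay az) +
      E.indicator (fun _ => 1) (s + ey ax ay az) + E.indicator (fun _ => 1) (s - ey ax ay az) := by
  obtain ⟨⟨h1, h2⟩, ⟨h3, h4⟩, -⟩ := neighbors_mem_dataSet hs
  have := Fintype.ofFinite (dataSet ax ay az)
  simp only [sympl, finsum_eq_sum_of_fintype, stab, Zop, mul_zero, add_zero, add_mul,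
    Finset.sum_add_distrib]
  rw [sum_ite_eq_mul _ h1, sum_ite_eq_mul _ h2, sum_ite_eq_mul _ h3, sum_ite_eq_mul _ h4]

lemma sympl_Xop_Zop (E F : Set (Amb ax ay az)) :
    sympl ax ay az (Xop ax ay az E) (Zop ax ay az F) =
      ((E ∩ F ∩ dataSet ax ay az).ncard : ZMod 2) := by
  classical
  have := Fintype.ofFinite (dataSet ax ay az)
  simp only [sympl, finsum_eq_sum_of_fintype, Xop, Zop, mul_zero, add_zero, Set.indicator_apply,
    ← ite_and, mul_ite, mul_one, Finset.sum_boole]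
  congr 1
  rw [← Set.ncard_coe_finset, ← Set.ncard_image_of_injective _ Subtype.val_injective]
  congr 1
  ext d
  simp only [Set.mem_image, Finset.mem_coe, Finset.mem_filter, Finset.mem_univ, true_and,
    Subtype.exists, Set.mem_inter_iff, exists_and_right, exists_eq_right]
  tauto

lemma sympl_eq_zero_of_mem_stabSpan {Q : Pauli ax ay az}
    (hQ : ∀ s ∉ dataSet ax ay az, sympl ax ay az (stab ax ay az s) Q = 0) {P : Pauli ax ay az}
    (hP : P ∈ stabSpan ax ay az) : sympl ax ay az P Q = 0 := by
  have := Fintype.ofFinite (dataSet ax ay az)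
  induction hP using Submodule.span_induction with
  | mem P hP =>
    obtain ⟨s, hs, rfl⟩ := hP
    exact hQ s hs
  | zero => simp [sympl]
  | add P P' _ _ h h' =>
    rw [← add_zero (0 : ZMod 2)]
    nth_rewrite 1 [← h]
    rw [← h']
    simp only [sympl, finsum_eq_sum_of_fintype, Prod.fst_add, Prod.snd_add, Pi.add_apply, add_mul,
      Finset.sum_add_distrib]
    ring
  | smul c P _ h =>
    rw [← mul_zero c, ← h]
    simp only [sympl, finsum_eq_sum_of_fintype, Prod.smul_fst, Prod.smul_snd, Pi.smul_apply,
      smul_eq_mul, mul_assoc, Finset.mul_sum, mul_add]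

lemma sympl_stab_Xop_Dxg {s : Amb ax ay az} (hs : s ∉ dataSet ax ay az) (g : Amb ax ay az) :
    sympl ax ay az (stab ax ay az s) (Xop ax ay az (Dxg ax ay az g)) = 0 := by
  classical
  rw [sympl_stab_Xop hs]
  simp only [Set.indicator_apply, mem_Dxg_iff, ey, ez, Prod.fst_add, Prod.snd_add, Prod.fst_sub,
    Prod.snd_sub, add_zero, sub_zero, par_sub_one, CharTwo.add_self_eq_zero, zero_add]

lemma sympl_stab_Zop_Dzg {s : Amb ax ay az} (hs : s ∉ dataSet ax ay az) (g : Amb ax ay az) :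
    sympl ax ay az (stab ax ay az s) (Zop ax ay az (Dzg ax ay az g)) = 0 := by
  classical
  rw [sympl_stab_Zop hs]
  simp only [Set.indicator_apply, mem_Dzg_iff, ey, ex, Prod.fst_add, Prod.snd_add, Prod.fst_sub,
    Prod.snd_sub, add_zero, sub_zero, par_sub_one, CharTwo.add_self_eq_zero, zero_add]

end Commutation

section Diagonals

lemma ncard_fiber_castHom {a α β : ℕ} (hα : 0 < α) (hβ : 0 < β) (ha : a = β * α)
    (h : 2 * α ∣ 2 * a) (c : ZMod (2 * a)) :
    {y : ZMod (2 * a) | ZMod.castHom h (ZMod (2 * α)) y = ZMod.castHom h (ZMod (2 * α)) c}.ncard =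
      β := by
  have himage : {y : ZMod (2 * a) |
      ZMod.castHom h (ZMod (2 * α)) y = ZMod.castHom h (ZMod (2 * α)) c} =
      (fun k : ℕ => c + ((2 * k * α : ℤ) : ZMod (2 * a))) '' (Finset.range β : Set ℕ) := by
    ext y
    obtain ⟨Y, rfl⟩ := ZMod.intCast_surjective y
    obtain ⟨C, rfl⟩ := ZMod.intCast_surjective c
    simp only [Set.mem_ofPred_eq, map_intCast, Set.mem_image, Finset.coe_range, Set.mem_Iio,
      ← Int.cast_add]
    rw [eq_comm, ZMod.intCast_eq_intCast_iff_dvd_sub]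
    push_cast
    rw [← exists_intCast_eq_add_iff hβ ha]
    constructor
    · rintro ⟨k, h0, h1, h2⟩
      refine ⟨k.toNat, by omega, ?_⟩
      rw [h2, ← Int.toNat_of_nonneg h0]
      push_cast
      rfl
    · rintro ⟨k, hk, hk'⟩
      exact ⟨k, by omega, by omega, by rw [← hk']; push_cast; rfl⟩
  have hinj : Set.InjOn (fun k : ℕ => c + ((2 * k * α : ℤ) : ZMod (2 * a)))
      (Finset.range β : Set ℕ) := by
    intro k hk m hm hkm
    simp only [Finset.coe_range, Set.mem_Iio] at hk hm
    simp only [add_right_inj] at hkm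
    rw [ZMod.intCast_eq_intCast_iff_dvd_sub, ha] at hkm
    have h1 : ((2 * α : ℤ)) * β ∣ (2 * α) * ((m : ℤ) - k) := by
      convert hkm using 1 <;> push_cast <;> ring
    have h2 := Int.dvd_of_mul_dvd_mul_left (by omega) h1
    have h3 := Int.eq_zero_of_abs_lt_dvd h2 (by rw [abs_lt]; constructor <;> omega)
    omega
  rw [himage, hinj.ncard_image, Set.ncard_coe_finset, Finset.card_range]

variable {ax ay az α : ℕ}

/-- The points of the plane `z = g_z` with `x + y ≡ g_x + g_y` modulo `2α`. -/
def diagonalXY (hx : 2 * α ∣ 2 * ax) (hy : 2 * α ∣ 2 * ay) (g : Amb ax ay az) :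
    Set (Amb ax ay az) :=
  {d | d.2.2 = g.2.2 ∧
    ZMod.castHom hx (ZMod (2 * α)) d.1 + ZMod.castHom hy (ZMod (2 * α)) d.2.1 =
      ZMod.castHom hx (ZMod (2 * α)) g.1 + ZMod.castHom hy (ZMod (2 * α)) g.2.1}

/-- The points of the plane `x = g_x` with `z + y ≡ g_z + g_y` modulo `2α`. -/
def diagonalZY (hz : 2 * α ∣ 2 * az) (hy : 2 * α ∣ 2 * ay) (g : Amb ax ay az) :
    Set (Amb ax ay az) :=
  {d | d.1 = g.1 ∧
    ZMod.castHom hz (ZMod (2 * α)) d.2.2 + ZMod.castHom hy (ZMod (2 * α)) d.2.1 =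
      ZMod.castHom hz (ZMod (2 * α)) g.2.2 + ZMod.castHom hy (ZMod (2 * α)) g.2.1}

lemma Dxg_inter_diagonalXY (hx : 2 * α ∣ 2 * ax) (hy : 2 * α ∣ 2 * ay) {g : Amb ax ay az}
    (hg : g ∈ dataSet ax ay az) :
    Dxg ax ay az g ∩ diagonalXY hx hy g ∩ dataSet ax ay az =
      (fun y => (g.1, y, g.2.2)) '' {y : ZMod (2 * ay) |
        ZMod.castHom hy (ZMod (2 * α)) y = ZMod.castHom hy (ZMod (2 * α)) g.2.1} := by
  ext ⟨d1, d2, d3⟩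
  simp only [Set.mem_inter_iff, mem_Dxg_iff, diagonalXY, Set.mem_ofPred_eq, Set.mem_image,
    Prod.mk.injEq]
  constructor
  · rintro ⟨⟨⟨rfl, -, -⟩, rfl, h⟩, -⟩
    exact ⟨d2, add_left_cancel h, rfl, rfl, rfl⟩
  · rintro ⟨y, h, rfl, rfl, rfl⟩
    have hpar : par y = par g.2.1 := by
      have h' := congrArg (ZMod.castHom (dvd_mul_right 2 α) (ZMod 2)) h
      simpa only [par, ← RingHom.comp_apply, ZMod.castHom_comp] using h'
    refine ⟨⟨⟨rfl, hpar, rfl⟩, rfl, by rw [h]⟩, ?_⟩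
    simp only [dataSet, Set.mem_ofPred_eq] at hg ⊢
    rw [hpar, hg]

lemma Dzg_inter_diagonalZY (hz : 2 * α ∣ 2 * az) (hy : 2 * α ∣ 2 * ay) {g : Amb ax ay az}
    (hg : g ∈ dataSet ax ay az) :
    diagonalZY hz hy g ∩ Dzg ax ay az g ∩ dataSet ax ay az =
      (fun y => (g.1, y, g.2.2)) '' {y : ZMod (2 * ay) |
        ZMod.castHom hy (ZMod (2 * α)) y = ZMod.castHom hy (ZMod (2 * α)) g.2.1} := by
  ext ⟨d1, d2, d3⟩
  simp only [Set.mem_inter_iff, mem_Dzg_iff, diagonalZY, Set.mem_ofPred_eq, Set.mem_image,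
    Prod.mk.injEq]
  constructor
  · rintro ⟨⟨⟨rfl, h⟩, rfl, -, -⟩, -⟩
    exact ⟨d2, add_left_cancel h, rfl, rfl, rfl⟩
  · rintro ⟨y, h, rfl, rfl, rfl⟩
    have hpar : par y = par g.2.1 := by
      have h' := congrArg (ZMod.castHom (dvd_mul_right 2 α) (ZMod 2)) h
      simpa only [par, ← RingHom.comp_apply, ZMod.castHom_comp] using h'
    refine ⟨⟨⟨rfl, by rw [h]⟩, rfl, hpar, rfl⟩, ?_⟩
    simp only [dataSet, Set.mem_ofPred_eq] at hg ⊢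
    rw [hpar, hg]

variable [NeZero ax] [NeZero ay] [NeZero az]

lemma sympl_stab_Zop_diagonalXY (hx : 2 * α ∣ 2 * ax) (hy : 2 * α ∣ 2 * ay) (g : Amb ax ay az)
    {s : Amb ax ay az} (hs : s ∉ dataSet ax ay az) :
    sympl ax ay az (stab ax ay az s) (Zop ax ay az (diagonalXY hx hy g)) = 0 := by
  classical
  rw [sympl_stab_Zop hs]
  simp only [Set.indicator_apply, diagonalXY, Set.mem_ofPred_eq, ex, ey, Prod.fst_add, Prod.snd_add,
    Prod.fst_sub, Prod.snd_sub, add_zero, sub_zero, map_add, map_sub, map_one, add_right_comm _ (1 : ZMod (2 * α)),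
    ← add_assoc, sub_add_eq_add_sub, ← add_sub_assoc]
  rw [add_assoc, CharTwo.add_self_eq_zero]

lemma sympl_stab_Xop_diagonalZY (hz : 2 * α ∣ 2 * az) (hy : 2 * α ∣ 2 * ay) (g : Amb ax ay az)
    {s : Amb ax ay az} (hs : s ∉ dataSet ax ay az) :
    sympl ax ay az (stab ax ay az s) (Xop ax ay az (diagonalZY hz hy g)) = 0 := by
  classical
  rw [sympl_stab_Xop hs]
  simp only [Set.indicator_apply, diagonalZY, Set.mem_ofPred_eq, ez, ey, Prod.fst_add, Prod.snd_add,
    Prod.fst_sub, Prod.snd_sub, add_zero, sub_zero, map_add, map_sub, map_one, add_right_comm _ (1 : ZMod (2 * α)),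
    ← add_assoc, sub_add_eq_add_sub, ← add_sub_assoc]
  rw [add_assoc, CharTwo.add_self_eq_zero]

lemma Xop_Dxg_notMem_stabSpan {β : ℕ} (hα : 0 < α) (hx : α ∣ ax) (hay : ay = β * α) (hβ : Odd β)
    {g : Amb ax ay az} (hg : g ∈ dataSet ax ay az) :
    Xop ax ay az (Dxg ax ay az g) ∉ stabSpan ax ay az := by
  have hx' : 2 * α ∣ 2 * ax := mul_dvd_mul_left 2 hx
  have hy' : 2 * α ∣ 2 * ay := mul_dvd_mul_left 2 ⟨β, by rw [hay, mul_comm]⟩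
  intro hmem
  have h := sympl_eq_zero_of_mem_stabSpan
    (fun s hs => sympl_stab_Zop_diagonalXY hx' hy' g hs) hmem
  rw [sympl_Xop_Zop, Dxg_inter_diagonalXY hx' hy' hg, Set.ncard_image_of_injective _
    (fun a b hab => by simpa using hab), ncard_fiber_castHom hα hβ.pos hay,
    ZMod.natCast_eq_zero_iff_even] at h
  exact Nat.not_even_iff_odd.mpr hβ h

lemma Zop_Dzg_notMem_stabSpan {β : ℕ} (hα : 0 < α) (hz : α ∣ az) (hay : ay = β * α) (hβ : Odd β)
    {g : Amb ax ay az} (hg : g ∈ dataSet ax ay az) :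
    Zop ax ay az (Dzg ax ay az g) ∉ stabSpan ax ay az := by
  have hz' : 2 * α ∣ 2 * az := mul_dvd_mul_left 2 hz
  have hy' : 2 * α ∣ 2 * ay := mul_dvd_mul_left 2 ⟨β, by rw [hay, mul_comm]⟩
  intro hmem
  have h := sympl_eq_zero_of_mem_stabSpan
    (fun s hs => sympl_stab_Xop_diagonalZY hz' hy' g hs) hmem
  rw [sympl_comm, sympl_Xop_Zop, Dzg_inter_diagonalZY hz' hy' hg, Set.ncard_image_of_injective _
    (fun a b hab => by simpa using hab), ncard_fiber_castHom hα hβ.pos hay,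
    ZMod.natCast_eq_zero_iff_even] at h
  exact Nat.not_even_iff_odd.mpr hβ h

end Diagonals

end Chamon

open Chamon

/-- each half-plane operator is a logical operator and is the
product of the corresponding `α` square logical operators:
`X|_{D_x^{g_i}} = Σ_j X_{Li}^j` and `Z|_{D_z^{g_i}} = Σ_j Z_{Li}^j`. -/
theorem chamon_halfplane_from_squares (ax ay az α βx βy βz : ℕ)
    (hax : 2 ≤ ax) (hay : 2 ≤ ay) (haz : 2 ≤ az)
    (hα : α = Nat.gcd (Nat.gcd ax ay) az)
    (hβx : ax = βx * α) (hβy : ay = βy * α) (hβz : az = βz * α)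
    (hodd : Odd βy) :
    ∀ i : Fin 4,
      (∀ s ∉ dataSet ax ay az,
          sympl ax ay az (stab ax ay az s) (Xop ax ay az (Dxg ax ay az (gpt ax ay az i))) = 0 ∧
          sympl ax ay az (stab ax ay az s) (Zop ax ay az (Dzg ax ay az (gpt ax ay az i))) = 0) ∧
      Xop ax ay az (Dxg ax ay az (gpt ax ay az i)) ∉ stabSpan ax ay az ∧
      Zop ax ay az (Dzg ax ay az (gpt ax ay az i)) ∉ stabSpan ax ay az ∧
      Xop ax ay az (Dxg ax ay az (gpt ax ay az i)) =
        ∑ j ∈ Finset.range α, Xop ax ay az (DxSqG ax ay az α βy βz i j) ∧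
      Zop ax ay az (Dzg ax ay az (gpt ax ay az i)) =
        ∑ j ∈ Finset.range α, Zop ax ay az (DzSqG ax ay az α βy βx i j) := by
  intro i
  have hα0 : 0 < α := Nat.pos_of_ne_zero (by rintro rfl; omega)
  have hx0 : 0 < βx := Nat.pos_of_ne_zero (by rintro rfl; omega)
  have hz0 : 0 < βz := Nat.pos_of_ne_zero (by rintro rfl; omega)
  have : NeZero ax := ⟨by omega⟩
  have : NeZero ay := ⟨by omega⟩
  have : NeZero az := ⟨by omega⟩
  exact ⟨fun s hs => ⟨sympl_stab_Xop_Dxg hs _, sympl_stab_Zop_Dzg hs _⟩,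
    Xop_Dxg_notMem_stabSpan hα0 (Dvd.intro_left _ hβx.symm) hβy hodd (gpt_mem_dataSet i),
    Zop_Dzg_notMem_stabSpan hα0 (Dvd.intro_left _ hβz.symm) hβy hodd (gpt_mem_dataSet i),
    Xop_Dxg_eq_sum hα0 hodd.pos hz0 hβy hβz i,
    Zop_Dzg_eq_sum hα0 hodd.pos hx0 hβy hβx i⟩
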